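/- Let n ≥ 1. A monad T on Type u is α-commutative for every surjection α belonging to F_surj^(n) if and only if T is commutative and n-relevant. -/

import Mathlib

universe u

/-- The canonical "double strength" `ψ` of a monad: first `p`, then `q`. -/
def monadPsi {T : Type u → Type u} [Monad T] {X Y : Type u} (p : T X) (q : T Y) :
    T (X × Y) := do
  let x ← p
  let y ← q
  pure (x, y)

/-- The reversed double strength `ψ'` of a monad: first `q`, then `p`. -/
def monadPsi' {T : Type u → Type u} [Monad T] {X Y : Type u} (p : T X) (q : T Y) :
    T (X × Y) := do
  let y ← q
  let x ← p
  pure (x, y)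

/-- The `n`-ary sequencing map `ψ⁽ⁿ⁾ : (Fin n → T X) → T (Fin n → X)`. -/
def monadPsiN {T : Type u → Type u} [Monad T] {X : Type u} :
    (n : ℕ) → (Fin n → T X) → T (Fin n → X)
  | 0, _ => pure Fin.elim0
  | n + 1, p => do
    let x ← p 0
    let v ← monadPsiN n (p ∘ Fin.succ)
    pure (Fin.cons x v)

/-- `T` is `α`-commutative for a function `α : Fin m → Fin n`. -/
def AlphaCommutative (T : Type u → Type u) [Monad T] {m n : ℕ} (α : Fin m → Fin n) : Prop :=
  ∀ (X : Type u) (p : Fin n → T X),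
    (fun v => v ∘ α) <$> monadPsiN n p = monadPsiN m (p ∘ α)

/-- `T` is commutative. -/
def MonadIsCommutative (T : Type u → Type u) [Monad T] : Prop :=
  ∀ (X Y : Type u) (p : T X) (q : T Y), monadPsi p q = monadPsi' p q

/-- `T` is affine. -/
def MonadIsAffine (T : Type u → Type u) [Monad T] : Prop :=
  ∀ (X : Type u) (p : T X),
    (fun _ => PUnit.unit.{u + 1}) <$> p = (pure PUnit.unit.{u + 1} : T PUnit.{u + 1})

/-- `T` is relevant. -/
def MonadIsRelevant (T : Type u → Type u) [Monad T] : Prop :=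
  ∀ (X : Type u) (p : T X), monadPsi p p = (fun x : X => (x, x)) <$> p

/-- `T` is `n`-relevant. -/
def MonadIsNRelevant (T : Type u → Type u) [Monad T] (n : ℕ) : Prop :=
  ∀ (X : Type u) (p : T X),
    monadPsiN n (fun _ => p) = (fun x => fun _ : Fin n => x) <$> p

section AlphaCommutativity

variable {T : Type u → Type u} [Monad T]

/-- Run the computations `q j` for `j` in a list, in order, storing each result in a function. -/
def runAndStore {J : Type} [DecidableEq J] {X : Type u} (q : J → T X) :
    List J → (J → X) → T (J → X)
  | [], g => pure g
  | j :: L, g => q j >>= fun x => runAndStore q L (Function.update g j x)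

/-- Overwrite the values of `g` at `e 0, …, e (n - 1)` by `v 0, …, v (n - 1)`, in this order. -/
def storeAlong {J : Type} [DecidableEq J] {X : Type u} :
    (n : ℕ) → (Fin n → J) → (Fin n → X) → (J → X) → (J → X)
  | 0, _, _, g => g
  | n + 1, e, v, g =>
    storeAlong n (e ∘ Fin.succ) (v ∘ Fin.succ) (Function.update g (e 0) (v 0))

variable {J : Type} [DecidableEq J] {X : Type u}

theorem storeAlong_apply_of_forall_ne {n : ℕ} (e : Fin n → J) (v : Fin n → X) (g : J → X)
    (j : J) (hj : ∀ i, e i ≠ j) : storeAlong n e v g j = g j := by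
  induction n generalizing g with
  | zero => rfl
  | succ n ih =>
    rw [storeAlong, ih (e ∘ Fin.succ) _ _ fun i => hj i.succ, Function.update_of_ne (hj 0).symm]

theorem storeAlong_apply_of_injective {n : ℕ} (e : Fin n → J) (he : Function.Injective e)
    (v : Fin n → X) (g : J → X) (i : Fin n) : storeAlong n e v g (e i) = v i := by
  induction n generalizing g with
  | zero => exact i.elim0
  | succ n ih =>
    rw [storeAlong]
    cases i using Fin.cases with
    | zero =>
      rw [storeAlong_apply_of_forall_ne (e ∘ Fin.succ) _ _ _ fun i h => Fin.succ_ne_zero i (he h),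
        Function.update_self]
    | succ i => exact ih (e ∘ Fin.succ) (he.comp (Fin.succ_injective n)) _ _ i

theorem storeAlong_const {n : ℕ} (e : Fin n → J) (x : X) (g : J → X) :
    storeAlong n e (fun _ => x) g = fun j => if j ∈ List.ofFn e then x else g j := by
  induction n generalizing g with
  | zero => simp [storeAlong]
  | succ n ih =>
    rw [storeAlong]
    refine (ih _ _).trans ?_
    funext j
    rw [List.ofFn_succ]
    by_cases h : j = e 0
    · simp [h]
    · simp [h, Function.comp_def]

theorem map_monadPsiN_succ [LawfulMonad T] {Y : Type u} {n : ℕ} (f : (Fin (n + 1) → X) → Y)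
    (p : Fin (n + 1) → T X) :
    f <$> monadPsiN (n + 1) p =
      p 0 >>= fun x => (fun v => f (Fin.cons x v)) <$> monadPsiN n (p ∘ Fin.succ) := by
  simp [monadPsiN, ← bind_pure_comp]

theorem map_comp_monadPsiN [LawfulMonad T] {Y : Type u} (f : X → Y) {n : ℕ} (p : Fin n → T X) :
    (fun v => f ∘ v) <$> monadPsiN n p = monadPsiN n (fun i => f <$> p i) := by
  induction n with
  | zero =>
    simp only [monadPsiN, map_pure]
    congr 1
    exact Subsingleton.elim _ _
  | succ n ih =>
    rw [map_monadPsiN_succ, monadPsiN]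
    simp only [bind_map_left, Function.comp_def] at ih ⊢
    simp only [← ih, bind_pure_comp, ← comp_map]
    congr! 3 with x
    funext v i
    cases i using Fin.cases <;> rfl

theorem runAndStore_ofFn [LawfulMonad T] (q : J → T X) {n : ℕ} (e : Fin n → J) (g : J → X) :
    runAndStore q (List.ofFn e) g =
      (fun v => storeAlong n e v g) <$> monadPsiN n (q ∘ e) := by
  induction n generalizing g with
  | zero => simp [runAndStore, storeAlong, monadPsiN]
  | succ n ih =>
    rw [List.ofFn_succ, runAndStore, map_monadPsiN_succ]
    refine bind_congr fun x => (ih (e ∘ Fin.succ) _).trans ?_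
    rfl

theorem runAndStore_finRange [LawfulMonad T] {n : ℕ} (q : Fin n → T X) (g : Fin n → X) :
    runAndStore q (List.finRange n) g = monadPsiN n q := by
  rw [← List.ofFn_id, runAndStore_ofFn]
  have h (v : Fin n → X) : storeAlong n id v g = v :=
    funext fun i => storeAlong_apply_of_injective id Function.injective_id v g i
  simp [h]

theorem runAndStore_append [LawfulMonad T] (q : J → T X) (L M : List J) (g : J → X) :
    runAndStore q (L ++ M) g = runAndStore q L g >>= runAndStore q M := by
  induction L generalizing g with
  | nil => simp [runAndStore]
  | cons j L ih => simp [runAndStore, ih]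

theorem MonadIsCommutative.bind_comm [LawfulMonad T] (h : MonadIsCommutative T) {Y Z : Type u}
    (p : T X) (q : T Y) (k : X → Y → T Z) :
    (p >>= fun x => q >>= fun y => k x y) = q >>= fun y => p >>= fun x => k x y := by
  simpa [monadPsi, monadPsi'] using congrArg (fun t => t >>= fun z => k z.1 z.2) (h X Y p q)

theorem MonadIsCommutative.runAndStore_perm [LawfulMonad T] (h : MonadIsCommutative T)
    (q : J → T X) {L M : List J} (hLM : L.Perm M) (hL : L.Nodup) (g : J → X) :
    runAndStore q L g = runAndStore q M g := by
  induction hLM generalizing g with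
  | nil => rfl
  | cons j _ ih =>
    exact bind_congr fun x => ih (List.nodup_cons.1 hL).2 _
  | swap i j L =>
    have hij : i ≠ j := by
      rintro rfl
      simp at hL
    simp only [runAndStore]
    rw [h.bind_comm]
    simp only [Function.update_comm hij]
  | trans h₁ _ ih₁ ih₂ => exact (ih₁ hL g).trans (ih₂ (h₁.nodup_iff.1 hL) g)

theorem MonadIsNRelevant.runAndStore_of_forall_eq [LawfulMonad T] {n : ℕ}
    (h : MonadIsNRelevant T (n + 1)) (q : J → T X) (p : T X) {k : ℕ} {L : List J}
    (hL : L.length = k * n + 1) (hq : ∀ j ∈ L, q j = p) (g : J → X) :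
    runAndStore q L g = (fun x j => if j ∈ L then x else g j) <$> p := by
  induction k generalizing L with
  | zero =>
    obtain ⟨j, rfl⟩ := List.length_eq_one_iff.1 (by simpa using hL)
    rw [runAndStore, hq j (by simp), ← bind_pure_comp]
    refine bind_congr fun x => congrArg pure (funext fun i => ?_)
    simp [Function.update_apply]
  | succ k ih =>
    obtain ⟨D, M, rfl, hD, hM⟩ : ∃ D M, L = D ++ M ∧ D.length = k * n + 1 ∧ M.length = n :=
      ⟨L.take (k * n + 1), L.drop (k * n + 1), by simp, by simp [hL, add_mul],
        by simp [hL, add_mul]⟩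
    subst hM
    have hqM : q ∘ M.get = fun _ => p := funext fun i => hq _ (by simp)
    have hrun (g : J → X) : runAndStore q M g =
        (fun v => storeAlong M.length M.get v g) <$> monadPsiN M.length (fun _ => p) := by
      rw [← hqM, ← runAndStore_ofFn, List.ofFn_get]
    rw [runAndStore_append, ih hD (fun j hj => hq j (List.mem_append_left _ hj)), bind_map_left]
    simp only [hrun]
    refine (map_monadPsiN_succ (fun w => storeAlong M.length M.get (w ∘ Fin.succ)
      fun j => if j ∈ D then w 0 else g j) fun _ => p).symm.trans ?_
    rw [h, ← comp_map]
    congr 1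
    funext x j
    simp only [Function.comp_def, storeAlong_const, List.ofFn_get, List.mem_append]
    by_cases hj : j ∈ M <;> simp [hj]

theorem runAndStore_flatMap_fibers [LawfulMonad T] {I : Type} [DecidableEq I] (α : J → I)
    (p : I → T X) (F : I → List J) (hF : ∀ i j, j ∈ F i ↔ α j = i)
    (hrun : ∀ i g, runAndStore (p ∘ α) (F i) g =
      (fun x j => if j ∈ F i then x else g j) <$> p i) (L : List I) (g : I → X) :
    runAndStore (p ∘ α) (L.flatMap F) (g ∘ α) = (fun v => v ∘ α) <$> runAndStore p L g := by
  induction L generalizing g with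
  | nil => simp [runAndStore]
  | cons i L ih =>
    rw [List.flatMap_cons, runAndStore_append, hrun, runAndStore, bind_map_left, map_bind]
    refine bind_congr fun x => ?_
    rw [← ih]
    congr 1
    funext j
    simp [hF, Function.update_apply]

theorem map_injective_of_injective [LawfulMonad T] {Y : Type u} {f : X → Y}
    (hf : Function.Injective f) : Function.Injective (fun p : T X => f <$> p) := by
  classical
  intro a b hab
  let r : Y → T X := fun y => if h : ∃ x, f x = y then pure h.choose else a
  have hr (x : X) : r (f x) = pure x := by
    have h : ∃ x', f x' = f x := ⟨x, rfl⟩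
    simp only [r, dif_pos h]
    rw [hf h.choose_spec]
  simpa [hr] using congrArg (· >>= r) hab

theorem map_comp_monadPsiN_eq_of_fibers [LawfulMonad T] {n : ℕ} (hc : MonadIsCommutative T)
    (hr : MonadIsNRelevant T (n + 1)) {ℓ m : ℕ} (α : Fin ℓ → Fin m)
    (hα : ∀ i : Fin m, ∃ k : ℕ,
      (Finset.univ.filter (fun j : Fin ℓ => α j = i)).card = k * n + 1)
    (p : Fin m → T X) (g : Fin m → X) :
    (fun v => v ∘ α) <$> monadPsiN m p = monadPsiN ℓ (p ∘ α) := by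
  let F (i : Fin m) : List (Fin ℓ) := (Finset.univ.filter fun j => α j = i).toList
  have hF (i j) : j ∈ F i ↔ α j = i := by simp [F]
  have hnodup : ((List.finRange m).flatMap F).Nodup := by
    rw [List.nodup_flatMap]
    refine ⟨fun i _ => Finset.nodup_toList _, (List.nodup_finRange m).imp ?_⟩
    intro i i' hii' j hj hj'
    exact hii' (((hF i j).1 hj).symm.trans ((hF i' j).1 hj'))
  have hperm : ((List.finRange m).flatMap F).Perm (List.finRange ℓ) :=
    (List.perm_ext_iff_of_nodup hnodup (List.nodup_finRange ℓ)).2 fun j => by simp [hF]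
  rw [← runAndStore_finRange p g, ← runAndStore_finRange (p ∘ α) (g ∘ α),
    ← hc.runAndStore_perm _ hperm hnodup]
  refine (runAndStore_flatMap_fibers α p F hF (fun i g => ?_) _ g).symm
  obtain ⟨k, hk⟩ := hα i
  exact hr.runAndStore_of_forall_eq _ _ (k := k) (by simpa [F] using hk)
    (fun j hj => by simp [(hF i j).1 hj]) g

theorem alphaCommutative_of_fibers [LawfulMonad T] {n : ℕ} (hc : MonadIsCommutative T)
    (hr : MonadIsNRelevant T (n + 1)) {ℓ m : ℕ} (α : Fin ℓ → Fin m)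
    (hα : ∀ i : Fin m, ∃ k : ℕ,
      (Finset.univ.filter (fun j : Fin ℓ => α j = i)).card = k * n + 1) :
    AlphaCommutative T α := by
  intro X p
  apply map_injective_of_injective (f := fun v : Fin ℓ → X => some ∘ v)
    (Option.some_injective X).comp_left
  have h := map_comp_monadPsiN_eq_of_fibers hc hr α hα (fun i => some <$> p i) (fun _ => none)
  rw [← map_comp_monadPsiN, ← comp_map] at h
  simp only [← comp_map]
  rw [map_comp_monadPsiN]
  exact h

theorem monadIsCommutative_of_alphaCommutative_swap [LawfulMonad T]
    (h : AlphaCommutative T (Equiv.swap (0 : Fin 2) 1)) : MonadIsCommutative T := by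
  intro X Y p q
  let f : X × Y → Fin 2 → X ⊕ Y := fun z => ![Sum.inl z.1, Sum.inr z.2]
  have hf : Function.Injective f := fun a b hab =>
    Prod.ext (Sum.inl_injective (congrFun hab 0)) (Sum.inr_injective (congrFun hab 1))
  apply map_injective_of_injective hf
  have hpq := h (X ⊕ Y) ![Sum.inr <$> q, Sum.inl <$> p]
  have hcons (x : X) (y : Y) : (Fin.cons (Sum.inr y) (Fin.cons (Sum.inl x) Fin.elim0) :
      Fin 2 → X ⊕ Y) ∘ Equiv.swap (0 : Fin 2) 1 = f (x, y) := by
    funext i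
    fin_cases i <;> rfl
  have hcons' (x : X) (y : Y) : (Fin.cons (Sum.inl x) (Fin.cons (Sum.inr y) Fin.elim0) :
      Fin 2 → X ⊕ Y) = f (x, y) := by
    funext i
    fin_cases i <;> rfl
  simp only [monadPsiN, map_bind, map_pure] at hpq
  simp [hcons, hcons'] at hpq
  simpa [monadPsi, monadPsi'] using hpq.symm

theorem monadIsNRelevant_of_alphaCommutative_const [LawfulMonad T] {n : ℕ}
    (h : AlphaCommutative T (fun _ : Fin n => (0 : Fin 1))) : MonadIsNRelevant T n := by
  intro X p
  have hp := h X fun _ => p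
  simp only [monadPsiN, map_pure, bind_pure_comp, ← comp_map] at hp
  exact hp.symm

end AlphaCommutativity

/-- For `n ≥ 1`, a monad `T` is `α`-commutative for every surjection `α`
belonging to `F_surj^(n)` iff `T` is commutative and `n`-relevant. -/
theorem alphaCommutative_surjFibers_iff_commutative_and_nRelevant
    {T : Type u → Type u} [Monad T] [LawfulMonad T] (n : ℕ) (hn : 1 ≤ n) :
    (∀ (ℓ m : ℕ) (α : Fin ℓ → Fin m), Function.Surjective α →
        (∀ i : Fin m, ∃ k : ℕ,
          (Finset.univ.filter (fun j : Fin ℓ => α j = i)).card = k * (n - 1) + 1) →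
        AlphaCommutative T α) ↔
      MonadIsCommutative T ∧ MonadIsNRelevant T n := by
  refine ⟨fun h => ⟨?_, ?_⟩, ?_⟩
  · refine monadIsCommutative_of_alphaCommutative_swap
      (h 2 2 _ (Equiv.surjective _) fun i => ⟨0, ?_⟩)
    rw [zero_mul]
    revert i
    decide
  · refine monadIsNRelevant_of_alphaCommutative_const (h n 1 _ (fun i => ⟨⟨0, hn⟩, ?_⟩)
      fun i => ⟨1, ?_⟩)
    · exact Subsingleton.elim _ _
    · rw [Finset.filter_true_of_mem fun _ _ => Subsingleton.elim _ _, Finset.card_fin]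
      omega
  · rintro ⟨hc, hr⟩ ℓ m α - hα
    obtain ⟨n, rfl⟩ := Nat.exists_eq_add_of_le' hn
    exact alphaCommutative_of_fibers hc hr α hα
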